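/- For every natural number n ≥ 1 and every real number p with 0 < p ≤ 1, it holds that n·p + Σ_{i=0}^{n-1} (1-p)^i ≥ (√n)/2. -/

import Mathlib

theorem stmt_11 (n : ℕ) (hn : 1 ≤ n) (p : ℝ) (hp0 : 0 < p) (hp1 : p ≤ 1) :
    Real.sqrt n / 2 ≤ n * p + ∑ i ∈ Finset.range n, (1 - p) ^ i := by
  have hS : (∑ i ∈ Finset.range n, (1 - p) ^ i) * p = 1 - (1 - p) ^ n := by
    have h := geom_sum_mul (1 - p) n
    linarith
  generalize (∑ i ∈ Finset.range n, (1 - p) ^ i) = S at hS ⊢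
  have hn' : (1 : ℝ) ≤ n := by exact_mod_cast hn
  have hs1 : 1 ≤ Real.sqrt n := Real.one_le_sqrt.mpr hn'
  have hss : Real.sqrt n * Real.sqrt n = n := Real.mul_self_sqrt (by linarith)
  have hb : 1 + (n : ℝ) * p ≤ (1 + p) ^ n := one_add_mul_le_pow (by linarith) n
  have hq : 0 ≤ (1 - p) ^ n := pow_nonneg (by linarith) n
  have h1 : (1 - p) ^ n * (1 + p) ^ n ≤ 1 := by
    rw [← mul_pow]
    exact pow_le_one₀ (mul_nonneg (by linarith) (by linarith)) (by nlinarith)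
  have h2 : (1 - p) ^ n * (1 + n * p) ≤ 1 :=
    (mul_le_mul_of_nonneg_left hb hq).trans h1
  have hy : 0 < 1 + (n : ℝ) * p := by positivity
  have h3 : (n : ℝ) ≤ S * (1 + n * p) := by
    have : (n : ℝ) * p ≤ S * (1 + n * p) * p := by
      have : S * (1 + n * p) * p = (1 - (1 - p) ^ n) * (1 + n * p) := by rw [← hS]; ring
      rw [this]; linarith
    exact le_of_mul_le_mul_right this hp0
  generalize Real.sqrt n = s at *
  have hx : (n : ℝ) * p = (1 + n * p) - 1 := by ring
  rw [hx]
  generalize 1 + (n : ℝ) * p = y at *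
  refine le_of_mul_le_mul_right ?_ hy
  nlinarith [sq_nonneg (y - s), mul_le_mul_of_nonneg_left hs1 hy.le]
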